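/- arXiv:2504.10516 — 2 statements merged into one kernel-verified Lean document; each statement's English description precedes it below -/
import Mathlib

section
/- For any odd integer d ≥ 3, every d×d complex matrix M admits the phase-space expansion M = Σ_{u ∈ (ZMod d)²} (Tr[A^u M]/d) · A^u; in particular the d² phase-space point operators A^u span the space of d×d complex matrices. -/
open Matrix

noncomputable section

/-- ω = exp(2πi/d). -/
def wUnit (d : ℕ) : ℂ := Complex.exp (2 * (Real.pi : ℂ) * Complex.I / d)

/-- τ = exp((d+1)πi/d). -/
def tUnit (d : ℕ) : ℂ := Complex.exp (((d : ℂ) + 1) * (Real.pi : ℂ) * Complex.I / d)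

/-- The shift operator, X|k⟩ = |k+1⟩. -/
def shiftX (d : ℕ) : Matrix (ZMod d) (ZMod d) ℂ :=
  Matrix.of fun i j => if i = j + 1 then 1 else 0

/-- The clock operator, Z|k⟩ = ω^k |k⟩. -/
def clockZ (d : ℕ) : Matrix (ZMod d) (ZMod d) ℂ :=
  Matrix.of fun i j => if i = j then wUnit d ^ j.val else 0

/-- The Heisenberg-Weyl operator T_u = τ^{-a₁a₂} Z^{a₁} X^{a₂}. -/
def HW (d : ℕ) [NeZero d] (u : ZMod d × ZMod d) : Matrix (ZMod d) (ZMod d) ℂ :=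
  tUnit d ^ (-(u.1 * u.2)).val • (clockZ d ^ (u.1).val * shiftX d ^ (u.2).val)

/-- The phase space point operator at the origin, A^0 = (1/d) Σ_u T_u. -/
def A0 (d : ℕ) [NeZero d] : Matrix (ZMod d) (ZMod d) ℂ :=
  (1 / (d : ℂ)) • ∑ u : ZMod d × ZMod d, HW d u

/-- The phase space point operator A^u = T_u A^0 (T_u)†. -/
def Apt (d : ℕ) [NeZero d] (u : ZMod d × ZMod d) : Matrix (ZMod d) (ZMod d) ℂ :=
  HW d u * A0 d * (HW d u)ᴴ

section

open ZMod (stdAddChar)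

variable {d : ℕ} [NeZero d]

theorem wUnit_pow_val (k : ZMod d) : wUnit d ^ k.val = stdAddChar k := by
  have h := ZMod.stdAddChar_coe (N := d) (k.val : ℤ)
  simp only [Int.cast_natCast, ZMod.natCast_zmod_val] at h
  rw [h, wUnit, ← Complex.exp_nat_mul]
  ring_nf

/-- For odd `d`, `τ` is `stdAddChar` evaluated at the inverse `h` of `2` modulo `d`. -/
theorem exists_half_tUnit_eq (hodd : Odd d) :
    ∃ h : ZMod d, 2 * h = 1 ∧ tUnit d = stdAddChar h := by
  obtain ⟨m, hm⟩ := hodd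
  have hcast : (2 * m + 1 : ZMod d) = 0 := by
    have := ZMod.natCast_self d
    rw [hm] at this ⊢
    exact_mod_cast this
  refine ⟨((m + 1 : ℤ) : ZMod d), ?_, ?_⟩
  · push_cast
    linear_combination hcast
  · have hd : (d : ℂ) = 2 * m + 1 := by rw [hm]; push_cast; ring
    rw [ZMod.stdAddChar_coe, tUnit]
    congr 2
    push_cast
    rw [hd]
    ring

theorem clockZ_pow_val (a : ZMod d) :
    clockZ d ^ a.val = Matrix.diagonal fun i => stdAddChar (a * i) := by
  have h : clockZ d = Matrix.diagonal fun i => stdAddChar i := by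
    ext i j
    by_cases hij : i = j <;> simp [clockZ, hij, wUnit_pow_val]
  rw [h, Matrix.diagonal_pow]
  congr 1
  ext i
  rw [Pi.pow_apply, ← AddChar.map_nsmul_eq_pow, nsmul_eq_mul, ZMod.natCast_zmod_val]

theorem shiftX_pow_apply (n : ℕ) (i j : ZMod d) :
    (shiftX d ^ n) i j = if i = j + n then 1 else 0 := by
  induction n generalizing j with
  | zero => simp [Matrix.one_apply]
  | succ n ih =>
    rw [pow_succ, Matrix.mul_apply]
    simp only [ih]
    simp [shiftX, add_assoc, add_comm (1 : ZMod d)]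

theorem HW_apply {h : ZMod d} (hτ : tUnit d = stdAddChar h) (a b i j : ZMod d) :
    HW d (a, b) i j = if i = j + b then stdAddChar (a * i - h * (a * b)) else 0 := by
  rw [HW, Matrix.smul_apply, clockZ_pow_val, Matrix.diagonal_mul, shiftX_pow_apply,
    ZMod.natCast_zmod_val, hτ, ← AddChar.map_nsmul_eq_pow, nsmul_eq_mul, ZMod.natCast_zmod_val]
  split_ifs
  · rw [smul_eq_mul, mul_one, ← AddChar.map_add_eq_mul]
    congr 1
    ring
  · simp

theorem sum_stdAddChar_mul (b : ZMod d) :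
    ∑ a : ZMod d, stdAddChar (a * b) = if b = 0 then (d : ℂ) else 0 := by
  rw [AddChar.sum_mulShift b (ZMod.isPrimitive_stdAddChar d), ZMod.card]
  split_ifs <;> simp

/-- `A^0` is the parity operator `|k⟩ ↦ |-k⟩`. -/
theorem A0_apply (hodd : Odd d) (i j : ZMod d) :
    A0 d i j = if i = -j then 1 else 0 := by
  obtain ⟨h, hh, hτ⟩ := exists_half_tUnit_eq hodd
  have hd : (d : ℂ) ≠ 0 := Nat.cast_ne_zero.mpr (NeZero.ne d)
  have key : ∀ a : ZMod d, ∑ b : ZMod d, HW d (a, b) i j = stdAddChar (a * (h * (i + j))) := by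
    intro a
    rw [Finset.sum_eq_single (i - j)]
    · rw [HW_apply hτ, if_pos (by ring)]
      congr 1
      linear_combination -(a * i) * hh
    · intro b _ hb
      rw [HW_apply hτ, if_neg]
      rintro rfl
      exact hb (by ring)
    · simp
  have hiff : h * (i + j) = 0 ↔ i = -j := by
    constructor
    · intro e
      linear_combination 2 * e - (i + j) * hh
    · rintro rfl
      ring
  rw [A0, Matrix.smul_apply, Matrix.sum_apply, Fintype.sum_prod_type]
  simp only [key, sum_stdAddChar_mul, hiff]
  split_ifs <;> simp [hd]

theorem Apt_apply (hodd : Odd d) (a b i j : ZMod d) :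
    Apt d (a, b) i j = if i + j = 2 * b then stdAddChar (a * (i - j)) else 0 := by
  obtain ⟨h, -, hτ⟩ := exists_half_tUnit_eq hodd
  have hsub : ∀ x y : ZMod d, x = y + b ↔ y = x - b := fun x y => by
    rw [eq_sub_iff_add_eq, eq_comm]
  have hiff : -(j - b) = i - b ↔ i + j = 2 * b := by
    constructor <;> intro e <;> linear_combination -e
  simp only [Apt, Matrix.mul_apply, Matrix.conjTranspose_apply, HW_apply hτ, A0_apply hodd, hsub,
    ite_mul, zero_mul, Finset.sum_ite_eq', Finset.mem_univ, if_true,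
    apply_ite star, star_zero, mul_ite, mul_zero, mul_one, hiff]
  split_ifs
  · rw [← starRingEnd_apply, ← AddChar.map_neg_eq_conj, ← AddChar.map_add_eq_mul]
    congr 1
    ring
  · simp

/-- The matrix-unit form of the completeness relation for the operators `A^u`. -/
theorem sum_Apt_mul_Apt (hodd : Odd d) (i j k l : ZMod d) :
    ∑ u : ZMod d × ZMod d, Apt d u k l * Apt d u i j =
      if k = j ∧ l = i then (d : ℂ) else 0 := by
  obtain ⟨h, hh, -⟩ := exists_half_tUnit_eq hodd
  have two_cancel : ∀ {x y : ZMod d}, 2 * x = 2 * y → x = y := fun {x y} e => by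
    linear_combination h * e - (x - y) * hh
  rw [Fintype.sum_prod_type_right, Finset.sum_eq_single (h * (i + j))]
  · have hij : i + j = 2 * (h * (i + j)) := by linear_combination -(i + j) * hh
    simp only [Apt_apply hodd, ← hij, if_true]
    by_cases hkl : k + l = i + j
    · simp only [hkl, if_true, ← AddChar.map_add_eq_mul, ← mul_add, sum_stdAddChar_mul]
      have hiff : k - l + (i - j) = 0 ↔ k = j ∧ l = i := by
        constructor
        · intro e
          have hkj : k = j := two_cancel (by linear_combination e + hkl)
          exact ⟨hkj, by linear_combination hkl - hkj⟩
        · rintro ⟨rfl, rfl⟩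
          ring
      simp only [hiff]
    · rw [if_neg]
      · simp [hkl]
      · rintro ⟨rfl, rfl⟩
        exact hkl (add_comm _ _)
  · intro b _ hb
    refine Finset.sum_eq_zero fun a _ => ?_
    rw [Apt_apply hodd a b i j, if_neg, mul_zero]
    intro e
    exact hb (by linear_combination -h * e - b * hh)
  · simp

theorem eq_sum_trace_smul_Apt (hodd : Odd d) (M : Matrix (ZMod d) (ZMod d) ℂ) :
    M = ∑ u : ZMod d × ZMod d, ((Apt d u * M).trace / d) • Apt d u := by
  have hd : (d : ℂ) ≠ 0 := Nat.cast_ne_zero.mpr (NeZero.ne d)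
  ext i j
  symm
  calc (∑ u : ZMod d × ZMod d, ((Apt d u * M).trace / d) • Apt d u) i j
      = ∑ u : ZMod d × ZMod d, ∑ k, ∑ l, M l k / d * (Apt d u k l * Apt d u i j) := by
        simp only [Matrix.sum_apply, Matrix.smul_apply, smul_eq_mul, Matrix.trace,
          Matrix.diag_apply, Matrix.mul_apply, Finset.sum_div, Finset.sum_mul]
        refine Finset.sum_congr rfl fun u _ => Finset.sum_congr rfl fun k _ =>
          Finset.sum_congr rfl fun l _ => ?_
        ring
    _ = ∑ k, ∑ l, M l k / d * ∑ u : ZMod d × ZMod d, Apt d u k l * Apt d u i j := by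
        rw [Finset.sum_comm]
        refine Finset.sum_congr rfl fun k _ => ?_
        rw [Finset.sum_comm]
        simp only [Finset.mul_sum]
    _ = M i j := by
        simp [sum_Apt_mul_Apt hodd, ite_and, hd]

end

/-- Phase-space expansion: every matrix M equals Σ_u (Tr[A^u M]/d)·A^u; in particular
the phase-space point operators span the space of d×d complex matrices. -/
theorem phase_space_expansion_and_span
    (d : ℕ) [NeZero d] (hd : 3 ≤ d) (hodd : Odd d) :
    (∀ M : Matrix (ZMod d) (ZMod d) ℂ,
      M = ∑ u : ZMod d × ZMod d, ((Apt d u * M).trace / d) • Apt d u) ∧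
    Submodule.span ℂ (Set.range (Apt d)) = ⊤ := by
  refine ⟨eq_sum_trace_smul_Apt hodd, ?_⟩
  rw [Submodule.eq_top_iff']
  intro M
  rw [eq_sum_trace_smul_Apt hodd M]
  exact Submodule.sum_mem _ fun u _ =>
    Submodule.smul_mem _ _ (Submodule.subset_span (Set.mem_range_self u))
end
end

section
/- Let d ≥ 2 be an integer and δ ∈ [0,1). Set t = (d−1)(1−δ)(d² + 2d(δ−1)δ − 2δ²)/d² (so t > 0), and define the normalized operator ω̂ = (λ₀·R^{T₃} − Q^{T₃} + C^{T₃})/t on (ℂ^d)^{⊗3}. Let V = P((12)), X̂ = P((23))^{T₃}, and define S₊ = ((I+V)/2)(I − 2X̂/(d+1))((I+V)/2), S₋ = ((I−V)/2)(I − 2X̂/(d−1))((I−V)/2), S₀ = (1/(d²−1))(d(X̂ + V X̂ V) − (X̂ V + V X̂)), S₁ = (1/(d²−1))(d(X̂ V + V X̂) − (X̂ + V X̂ V)), S₂ = (X̂ − V X̂ V)/√(d²−1), S₃ = i(X̂ V − V X̂)/√(d²−1). Then Tr[ω̂ S₊] = (d²((δ−2)δ+2) + dδ² − 2δ²)/(2d²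 + 4d(δ−1)δ − 4δ²), Tr[ω̂ S₋] = −(d−2)δ(dδ − 2d − δ)/(2d² + 4d(δ−1)δ − 4δ²), and Tr[ω̂ S_j] = 0 for j ∈ {0,1,2,3}; moreover Tr[ω̂ S₊] ≥ 0, Tr[ω̂ S₋] ≥ 0, and Tr[ω̂ S₊] + Tr[ω̂ S₋] = 1. -/
open Matrix

noncomputable section

/-- Index type for (ℂ^d)^{⊗3}. -/
abbrev Idx (d : ℕ) := Fin 3 → Fin d

/-- The operator on (ℂ^d)^{⊗3} permuting the tensor factors according to c ∈ S₃:
P(c)(v₁⊗v₂⊗v₃) = v_{c⁻¹(1)}⊗v_{c⁻¹(2)}⊗v_{c⁻¹(3)}. -/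
def Perm3 (d : ℕ) (c : Equiv.Perm (Fin 3)) : Matrix (Idx d) (Idx d) ℂ :=
  Matrix.of fun i j => if ∀ k, i k = j (c⁻¹ k) then 1 else 0

/-- The projector onto the symmetric subspace of (ℂ^d)^{⊗3}. -/
def projSym3 (d : ℕ) : Matrix (Idx d) (Idx d) ℂ :=
  ((6 : ℂ))⁻¹ • ∑ c : Equiv.Perm (Fin 3), Perm3 d c

/-- The depolarizing map 𝒟_δ applied to tensor factor s of an operator on (ℂ^d)^{⊗3}. -/
def depOn (d : ℕ) (δ : ℝ) (s : Fin 3) (M : Matrix (Idx d) (Idx d) ℂ) :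
    Matrix (Idx d) (Idx d) ℂ :=
  Matrix.of fun i j => (1 - (δ : ℂ)) * M i j +
    ((δ : ℂ) / d) *
      (if i s = j s then ∑ k : Fin d, M (Function.update i s k) (Function.update j s k) else 0)

/-- D(n,d) = binom(n+d−1, n), the dimension of the symmetric subspace. -/
def Dnd (n d : ℕ) : ℕ := Nat.choose (n + d - 1) n

/-- Q = (𝒟_δ⊗𝒟_δ⊗id)(Π₃)/D(3,d). -/
def Qop (d : ℕ) (δ : ℝ) : Matrix (Idx d) (Idx d) ℂ :=
  ((Dnd 3 d : ℂ))⁻¹ • depOn d δ 0 (depOn d δ 1 (projSym3 d))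

/-- R = ((𝒟_δ⊗𝒟_δ)(Π₂)/D(2,d)) ⊗ I_d, using Π₂ ⊗ I = (I + P((12)))/2 on (ℂ^d)^{⊗3}. -/
def Rop (d : ℕ) (δ : ℝ) : Matrix (Idx d) (Idx d) ℂ :=
  ((Dnd 2 d : ℂ))⁻¹ •
    depOn d δ 0 (depOn d δ 1 (((2 : ℂ))⁻¹ • (1 + Perm3 d (Equiv.swap 0 1))))

/-- The partial transpose on the third tensor factor:
(M^{T₃})_{(i₁i₂i₃),(j₁j₂j₃)} = M_{(i₁i₂j₃),(j₁j₂i₃)}. -/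
def pt3 (d : ℕ) (M : Matrix (Idx d) (Idx d) ℂ) : Matrix (Idx d) (Idx d) ℂ :=
  Matrix.of fun i j => M (Function.update i 2 (j 2)) (Function.update j 2 (i 2))


/-- Partial trace over factor `s`, tensored with the identity on that factor. -/
def traceOutOn (d : ℕ) (s : Fin 3) (M : Matrix (Idx d) (Idx d) ℂ) : Matrix (Idx d) (Idx d) ℂ :=
  Matrix.of fun i j =>
    if i s = j s then ∑ k : Fin d, M (Function.update i s k) (Function.update j s k) else 0

lemma depOn_eq (d : ℕ) (δ : ℝ) (s : Fin 3) (M : Matrix (Idx d) (Idx d) ℂ) :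
    depOn d δ s M = (1 - (δ : ℂ)) • M + ((δ : ℂ) / d) • traceOutOn d s M := by
  ext i j
  simp [depOn, traceOutOn]

lemma traceOutOn_add (d : ℕ) (s : Fin 3) (M N : Matrix (Idx d) (Idx d) ℂ) :
    traceOutOn d s (M + N) = traceOutOn d s M + traceOutOn d s N := by
  ext i j
  by_cases h : i s = j s <;> simp [traceOutOn, h, Finset.sum_add_distrib]

lemma traceOutOn_smul (d : ℕ) (s : Fin 3) (a : ℂ) (M : Matrix (Idx d) (Idx d) ℂ) :
    traceOutOn d s (a • M) = a • traceOutOn d s M := by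
  ext i j
  by_cases h : i s = j s <;> simp [traceOutOn, h, Finset.mul_sum]

lemma depOn_add (d : ℕ) (δ : ℝ) (s : Fin 3) (M N : Matrix (Idx d) (Idx d) ℂ) :
    depOn d δ s (M + N) = depOn d δ s M + depOn d δ s N := by
  simp only [depOn_eq, traceOutOn_add, smul_add]
  abel

lemma depOn_smul (d : ℕ) (δ : ℝ) (s : Fin 3) (a : ℂ) (M : Matrix (Idx d) (Idx d) ℂ) :
    depOn d δ s (a • M) = a • depOn d δ s M := by
  simp only [depOn_eq, traceOutOn_smul, smul_add, smul_comm a]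

lemma Perm3_apply (d : ℕ) (c : Equiv.Perm (Fin 3)) (i j : Idx d) :
    Perm3 d c i j = if i ∘ c = j then 1 else 0 := by
  have h : (∀ k, i k = j (c⁻¹ k)) ↔ i ∘ c = j := by
    refine ⟨fun h => funext fun k => by simp [h], ?_⟩
    rintro rfl k
    simp
  rw [Perm3, Matrix.of_apply]
  simp only [h]

lemma Perm3_one (d : ℕ) : Perm3 d 1 = 1 := by
  ext i j
  simp [Perm3_apply, Matrix.one_apply]

lemma Perm3_mul_apply (d : ℕ) (c : Equiv.Perm (Fin 3)) (M : Matrix (Idx d) (Idx d) ℂ)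
    (i j : Idx d) : (Perm3 d c * M) i j = M (i ∘ c) j := by
  simp [Matrix.mul_apply, Perm3_apply]

lemma mul_Perm3_apply (d : ℕ) (c : Equiv.Perm (Fin 3)) (M : Matrix (Idx d) (Idx d) ℂ)
    (i j : Idx d) : (M * Perm3 d c) i j = M i (j ∘ ⇑c⁻¹) := by
  have h (k : Idx d) : k ∘ c = j ↔ k = j ∘ ⇑c⁻¹ := by
    constructor
    · rintro rfl
      ext x
      simp
    · rintro rfl
      ext x
      simp
  simp [Matrix.mul_apply, Perm3_apply, h]

lemma Perm3_mul (d : ℕ) (b c : Equiv.Perm (Fin 3)) :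
    Perm3 d (b * c) = Perm3 d b * Perm3 d c := by
  ext i j
  rw [Perm3_mul_apply, Perm3_apply, Perm3_apply]
  rfl

/-- Tracing out a fixed point of a permutation yields a factor `d`. -/
lemma traceOutOn_Perm3_of_fixed (d : ℕ) {s : Fin 3} {c : Equiv.Perm (Fin 3)} (h : c s = s) :
    traceOutOn d s (Perm3 d c) = (d : ℂ) • Perm3 d c := by
  ext i j
  by_cases hij : i s = j s
  · have key (k : Fin d) : Function.update i s k ∘ c = Function.update j s k ↔ i ∘ c = j := by
      simp only [funext_iff, Function.comp_apply, Function.update_apply]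
      refine forall_congr' fun x => ?_
      by_cases hx : x = s
      · subst hx
        simp [h, hij]
      · have : c x ≠ s := fun e => hx (c.injective (e.trans h.symm))
        simp [hx, this]
    simp only [traceOutOn, Matrix.of_apply, Perm3_apply, hij, if_true, key, Matrix.smul_apply]
    split_ifs <;> simp
  · have : i ∘ c ≠ j := fun e => hij (by rw [← e]; simp [h])
    simp [traceOutOn, Perm3_apply, hij, this]

/-- Tracing out a non-fixed point of a permutation removes it from its cycle. -/
lemma traceOutOn_Perm3_of_ne (d : ℕ) {s : Fin 3} {c : Equiv.Perm (Fin 3)} (h : c s ≠ s) :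
    traceOutOn d s (Perm3 d c) = Perm3 d (Equiv.swap s (c s) * c) := by
  ext i j
  have hs : (Equiv.swap s (c s) * c) s = s := by simp
  by_cases hij : i s = j s
  · have key (k : Fin d) : Function.update i s k ∘ c = Function.update j s k ↔
        k = i (c s) ∧ i ∘ ⇑(Equiv.swap s (c s) * c) = j := by
      simp only [funext_iff, Function.comp_apply, Function.update_apply, Equiv.Perm.mul_apply]
      constructor
      · intro H
        have h1 := H s
        simp only [h, if_false, if_true] at h1
        refine ⟨h1.symm, fun x => ?_⟩
        by_cases hx : x = s
        · subst hx; simp [hij]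
        · have h2 := H x
          by_cases hc : c x = s
          · simp only [hc, hx, if_true, if_false] at h2
            simp [hc, h1, h2]
          · have : c x ≠ c s := fun e => hx (c.injective e)
            simp only [hc, hx, if_false] at h2
            rw [Equiv.swap_apply_of_ne_of_ne hc this, h2]
      · rintro ⟨rfl, H⟩ x
        by_cases hx : x = s
        · subst hx; simp [h]
        · have h2 := H x
          by_cases hc : c x = s
          · simpa [hc, hx] using h2
          · have : c x ≠ c s := fun e => hx (c.injective e)
            rw [Equiv.swap_apply_of_ne_of_ne hc this] at h2
            simp [hc, hx, h2]
    simp only [traceOutOn, Matrix.of_apply, Perm3_apply, hij, if_true, key, ite_and]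
    simp
  · have : i ∘ ⇑(Equiv.swap s (c s) * c) ≠ j := fun e => hij (by
      rw [← e, Function.comp_apply, hs])
    simp only [traceOutOn, Matrix.of_apply, Perm3_apply, hij, this, if_false]

lemma pt3_add (d : ℕ) (M N : Matrix (Idx d) (Idx d) ℂ) : pt3 d (M + N) = pt3 d M + pt3 d N :=
  rfl

lemma pt3_sub (d : ℕ) (M N : Matrix (Idx d) (Idx d) ℂ) : pt3 d (M - N) = pt3 d M - pt3 d N :=
  rfl

lemma pt3_smul (d : ℕ) (a : ℂ) (M : Matrix (Idx d) (Idx d) ℂ) :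
    pt3 d (a • M) = a • pt3 d M :=
  rfl

lemma pt3_Perm3_mul (d : ℕ) {c : Equiv.Perm (Fin 3)} (h : c 2 = 2)
    (M : Matrix (Idx d) (Idx d) ℂ) : pt3 d (Perm3 d c * M) = Perm3 d c * pt3 d M := by
  ext i j
  simp only [pt3, Perm3_mul_apply, Matrix.of_apply, Function.comp_apply, h]
  congr 1
  ext x
  simp [Function.update_apply, ← c.injective.eq_iff (a := x) (b := 2), h]

lemma pt3_mul_Perm3 (d : ℕ) {c : Equiv.Perm (Fin 3)} (h : c 2 = 2)
    (M : Matrix (Idx d) (Idx d) ℂ) : pt3 d (M * Perm3 d c) = pt3 d M * Perm3 d c := by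
  have h' : c⁻¹ 2 = 2 := by rw [Equiv.Perm.inv_eq_iff_eq, h]
  ext i j
  simp only [pt3, mul_Perm3_apply, Matrix.of_apply, Function.comp_apply, h']
  congr 1
  ext x
  simp only [Function.update_apply, Function.comp_apply,
    ← (c⁻¹).injective.eq_iff (a := x) (b := 2), h']

lemma pt3_one (d : ℕ) : pt3 d 1 = 1 := by
  ext i j
  have h : Function.update i 2 (j 2) = Function.update j 2 (i 2) ↔ i = j := by
    simp [funext_iff, Fin.forall_fin_succ, Function.update_apply, eq_comm]
  simp [pt3, Matrix.one_apply, h]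

lemma pt3_Perm3 (d : ℕ) {c : Equiv.Perm (Fin 3)} (h : c 2 = 2) :
    pt3 d (Perm3 d c) = Perm3 d c := by
  simpa [pt3_one] using pt3_Perm3_mul d h 1

lemma trace_pt3 (d : ℕ) (M : Matrix (Idx d) (Idx d) ℂ) : (pt3 d M).trace = M.trace := by
  simp [Matrix.trace, pt3]

lemma sum_Idx {d : ℕ} (f : Idx d → ℂ) : ∑ k, f k = ∑ a, ∑ b, ∑ c, f ![a, b, c] := by
  let e : Idx d ≃ Fin d × Fin d × Fin d :=
    { toFun := fun k => (k 0, k 1, k 2)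
      invFun := fun p => ![p.1, p.2.1, p.2.2]
      left_inv := fun k => by ext x; fin_cases x <;> rfl
      right_inv := fun p => rfl }
  rw [← e.symm.sum_comp f, Fintype.sum_prod_type]
  simp_rw [Fintype.sum_prod_type]
  rfl

lemma pt3_swap_apply (d : ℕ) (i j : Idx d) :
    pt3 d (Perm3 d (Equiv.swap 1 2)) i j =
      if i 0 = j 0 then if j 2 = j 1 then if i 1 = i 2 then 1 else 0 else 0 else 0 := by
  simp [pt3, Perm3_apply, funext_iff, Fin.forall_fin_succ, Function.update_apply, ite_and,
    Equiv.swap_apply_def]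

lemma pt3_swap_mul_self (d : ℕ) :
    pt3 d (Perm3 d (Equiv.swap 1 2)) * pt3 d (Perm3 d (Equiv.swap 1 2)) =
      (d : ℂ) • pt3 d (Perm3 d (Equiv.swap 1 2)) := by
  ext i j
  simp only [Matrix.mul_apply, pt3_swap_apply, sum_Idx, Matrix.smul_apply]
  by_cases h1 : i 1 = i 2 <;> by_cases h2 : j 2 = j 1 <;> simp [h1, h2]

lemma pt3_swap_mul_swap_mul (d : ℕ) :
    pt3 d (Perm3 d (Equiv.swap 1 2)) * Perm3 d (Equiv.swap 0 1) *
      pt3 d (Perm3 d (Equiv.swap 1 2)) = pt3 d (Perm3 d (Equiv.swap 1 2)) := by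
  ext i j
  rw [Matrix.mul_apply]
  simp only [mul_Perm3_apply, pt3_swap_apply, sum_Idx]
  by_cases h1 : i 1 = i 2 <;> by_cases h2 : j 2 = j 1 <;> simp [h1, h2, Equiv.swap_apply_def]
  congr

lemma trace_Perm3_swap_zero_one (d : ℕ) :
    (Perm3 d (Equiv.swap 0 1)).trace = (d : ℂ) ^ 2 := by
  have h (a b c : Fin d) : ![a, b, c] ∘ Equiv.swap (0 : Fin 3) 1 = ![a, b, c] ↔ a = b := by
    simp [funext_iff, Fin.forall_fin_succ]
    grind
  simp only [Matrix.trace, Matrix.diag_apply, sum_Idx, Perm3_apply, h]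
  simp [pow_two]

lemma trace_Perm3_swap_one_two (d : ℕ) :
    (Perm3 d (Equiv.swap 1 2)).trace = (d : ℂ) ^ 2 := by
  have h (a b c : Fin d) : ![a, b, c] ∘ Equiv.swap (1 : Fin 3) 2 = ![a, b, c] ↔ b = c := by
    simp [funext_iff, Fin.forall_fin_succ, Equiv.swap_apply_def]
    grind
  simp only [Matrix.trace, Matrix.diag_apply, sum_Idx, Perm3_apply, h]
  simp [pow_two]

lemma trace_Perm3_cycle (d : ℕ) :
    (Perm3 d (Equiv.swap 1 2 * Equiv.swap 0 1)).trace = d := by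
  have h (a b c : Fin d) :
      ![a, b, c] ∘ (Equiv.swap 1 2 * Equiv.swap 0 1 : Equiv.Perm (Fin 3)) =
        ![a, b, c] ↔ a = b ∧ b = c := by
    simp [funext_iff, Fin.forall_fin_succ, Equiv.swap_apply_def]
    grind
  simp only [Matrix.trace, Matrix.diag_apply, sum_Idx, Perm3_apply, h]
  simp [ite_and]

lemma inv_Dnd_two (d : ℕ) : (Dnd 2 d : ℂ)⁻¹ = 2 * ((d : ℂ) * (d + 1))⁻¹ := by
  have h : d * (d + 1) = 2 * Dnd 2 d := by
    have := Nat.ascFactorial_eq_factorial_mul_choose' d 2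
    simp only [Nat.ascFactorial_succ, Nat.ascFactorial_zero, Nat.factorial] at this
    rw [Dnd, add_comm 2 d]
    linarith
  have h' := congrArg (Nat.cast (R := ℂ)) h
  push_cast at h'
  rw [h', mul_inv, mul_inv_cancel_left₀ (by norm_num)]

lemma inv_Dnd_three (d : ℕ) : (Dnd 3 d : ℂ)⁻¹ = 6 * ((d : ℂ) * (d + 1) * (d + 2))⁻¹ := by
  have h : d * (d + 1) * (d + 2) = 6 * Dnd 3 d := by
    have := Nat.ascFactorial_eq_factorial_mul_choose' d 3
    simp only [Nat.ascFactorial_succ, Nat.ascFactorial_zero, Nat.factorial] at this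
    rw [Dnd, add_comm 3 d]
    linarith
  have h' := congrArg (Nat.cast (R := ℂ)) h
  push_cast at h'
  rw [h', mul_inv, mul_inv_cancel_left₀ (by norm_num)]

lemma depOn_Perm3_of_fixed {d : ℕ} (hd : d ≠ 0) (δ : ℝ) {s : Fin 3} {c : Equiv.Perm (Fin 3)}
    (h : c s = s) : depOn d δ s (Perm3 d c) = Perm3 d c := by
  have : (d : ℂ) ≠ 0 := Nat.cast_ne_zero.mpr hd
  rw [depOn_eq, traceOutOn_Perm3_of_fixed d h, smul_smul, div_mul_cancel₀ _ this, ← add_smul,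
    sub_add_cancel, one_smul]

lemma depOn_Perm3_of_ne (d : ℕ) (δ : ℝ) {s : Fin 3} {b c : Equiv.Perm (Fin 3)}
    (h : c s ≠ s) (hb : Equiv.swap s (c s) * c = b) :
    depOn d δ s (Perm3 d c) = (1 - (δ : ℂ)) • Perm3 d c + ((δ : ℂ) / d) • Perm3 d b := by
  rw [depOn_eq, traceOutOn_Perm3_of_ne d h, hb]

lemma sum_Perm3 (d : ℕ) : ∑ c : Equiv.Perm (Fin 3), Perm3 d c =
    Perm3 d 1 + Perm3 d (Equiv.swap 0 1) + Perm3 d (Equiv.swap 1 2) + Perm3 d (Equiv.swap 0 2)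
      + Perm3 d (Equiv.swap 0 1 * Equiv.swap 1 2) + Perm3 d (Equiv.swap 1 2 * Equiv.swap 0 1) := by
  have h : (Finset.univ : Finset (Equiv.Perm (Fin 3))) = {1, Equiv.swap 0 1, Equiv.swap 1 2,
      Equiv.swap 0 2, Equiv.swap 0 1 * Equiv.swap 1 2, Equiv.swap 1 2 * Equiv.swap 0 1} := by
    decide
  rw [h, Finset.sum_insert (by decide), Finset.sum_insert (by decide),
    Finset.sum_insert (by decide), Finset.sum_insert (by decide), Finset.sum_insert (by decide),
    Finset.sum_singleton]
  abel

lemma depOn_depOn_swap_zero_one {d : ℕ} (hd : d ≠ 0) (δ : ℝ) :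
    depOn d δ 0 (depOn d δ 1 (Perm3 d (Equiv.swap 0 1))) =
      (1 - (δ : ℂ)) ^ 2 • Perm3 d (Equiv.swap 0 1)
        + ((2 - (δ : ℂ)) * (δ / d)) • Perm3 d 1 := by
  rw [depOn_Perm3_of_ne d δ (b := 1) (by decide) (by decide), depOn_add, depOn_smul, depOn_smul,
    depOn_Perm3_of_ne d δ (b := 1) (by decide) (by decide), depOn_Perm3_of_fixed hd δ (by decide)]
  module

lemma depOn_depOn_swap_one_two {d : ℕ} (hd : d ≠ 0) (δ : ℝ) :
    depOn d δ 0 (depOn d δ 1 (Perm3 d (Equiv.swap 1 2))) =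
      (1 - (δ : ℂ)) • Perm3 d (Equiv.swap 1 2) + ((δ : ℂ) / d) • Perm3 d 1 := by
  rw [depOn_Perm3_of_ne d δ (b := 1) (by decide) (by decide), depOn_add, depOn_smul, depOn_smul,
    depOn_Perm3_of_fixed hd δ (by decide), depOn_Perm3_of_fixed hd δ (by decide)]

lemma depOn_depOn_swap_zero_two {d : ℕ} (hd : d ≠ 0) (δ : ℝ) :
    depOn d δ 0 (depOn d δ 1 (Perm3 d (Equiv.swap 0 2))) =
      (1 - (δ : ℂ)) • Perm3 d (Equiv.swap 0 2) + ((δ : ℂ) / d) • Perm3 d 1 := by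
  rw [depOn_Perm3_of_fixed hd δ (by decide),
    depOn_Perm3_of_ne d δ (b := 1) (by decide) (by decide)]

/-- The two depolarizing maps acting on a permutation `c` whose cycle contains all factors. -/
lemma depOn_depOn_cycle {d : ℕ} (δ : ℝ) {c : Equiv.Perm (Fin 3)}
    (h1 : c 1 ≠ 1) (h0 : c 0 ≠ 0) (hb1 : Equiv.swap 1 (c 1) * c = Equiv.swap 0 2)
    (hb0 : Equiv.swap 0 (c 0) * c = Equiv.swap 1 2) :
    depOn d δ 0 (depOn d δ 1 (Perm3 d c)) =
      (1 - (δ : ℂ)) ^ 2 • Perm3 d c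
        + ((1 - (δ : ℂ)) * (δ / d)) • (Perm3 d (Equiv.swap 1 2) + Perm3 d (Equiv.swap 0 2))
        + ((δ : ℂ) / d) ^ 2 • Perm3 d 1 := by
  rw [depOn_Perm3_of_ne d δ h1 hb1, depOn_add, depOn_smul, depOn_smul,
    depOn_Perm3_of_ne d δ h0 hb0, depOn_Perm3_of_ne d δ (b := 1) (by decide) (by decide)]
  module

lemma pt3_Rop {d : ℕ} (hd : d ≠ 0) (δ : ℝ) :
    pt3 d (Rop d δ) = ((d : ℂ) * (d + 1))⁻¹ •
      ((1 + (2 - (δ : ℂ)) * (δ / d)) • (1 : Matrix (Idx d) (Idx d) ℂ)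
        + (1 - (δ : ℂ)) ^ 2 • Perm3 d (Equiv.swap 0 1)) := by
  rw [Rop, ← Perm3_one, depOn_smul, depOn_smul, depOn_add, depOn_add,
    depOn_Perm3_of_fixed hd δ (by decide), depOn_Perm3_of_fixed hd δ (by decide),
    depOn_depOn_swap_zero_one hd, inv_Dnd_two]
  simp only [pt3_add, pt3_smul, pt3_Perm3 d (c := 1) rfl,
    pt3_Perm3 d (c := Equiv.swap 0 1) (by decide)]
  module

lemma pt3_Qop {d : ℕ} (hd : d ≠ 0) (δ : ℝ) {V X : Matrix (Idx d) (Idx d) ℂ}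
    (hV : V = Perm3 d (Equiv.swap 0 1)) (hX : X = pt3 d (Perm3 d (Equiv.swap 1 2))) :
    pt3 d (Qop d δ) = ((d : ℂ) * (d + 1) * (d + 2))⁻¹ •
      ((1 + (4 - (δ : ℂ)) * (δ / d) + 2 * (δ / d) ^ 2) • (1 : Matrix (Idx d) (Idx d) ℂ)
        + (1 - (δ : ℂ)) ^ 2 • V
        + ((1 - (δ : ℂ)) * (1 + 2 * (δ / d))) • (X + V * X * V)
        + (1 - (δ : ℂ)) ^ 2 • (X * V + V * X)) := by
  have h02 : (Equiv.swap 0 2 : Equiv.Perm (Fin 3)) =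
      Equiv.swap 0 1 * Equiv.swap 1 2 * Equiv.swap 0 1 := by decide
  have hf : (Equiv.swap 0 1 : Equiv.Perm (Fin 3)) 2 = 2 := by decide
  rw [Qop, projSym3, sum_Perm3]
  simp only [depOn_add, depOn_smul]
  rw [depOn_Perm3_of_fixed hd δ (s := 1) (c := 1) rfl,
    depOn_Perm3_of_fixed hd δ (s := 0) (c := 1) rfl,
    depOn_depOn_swap_zero_one hd, depOn_depOn_swap_one_two hd, depOn_depOn_swap_zero_two hd,
    depOn_depOn_cycle δ (by decide) (by decide) (by decide) (by decide),
    depOn_depOn_cycle δ (by decide) (by decide) (by decide) (by decide), inv_Dnd_three, h02]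
  simp only [Perm3_mul, pt3_add, pt3_smul, pt3_mul_Perm3 d hf, pt3_Perm3_mul d hf,
    pt3_Perm3 d hf, Perm3_one, pt3_one, hX, hV]
  module

/-- Traces of `V`-symmetric elements of the algebra generated by `V` and `X` against its
spanning words. -/
lemma trace_mul_word {d : ℕ} {V X W : Matrix (Idx d) (Idx d) ℂ} {a b c e : ℂ}
    (hV : V = Perm3 d (Equiv.swap 0 1)) (hX : X = pt3 d (Perm3 d (Equiv.swap 1 2)))
    (hW : W = a • 1 + b • V + c • (X + V * X * V) + e • (X * V + V * X)) :
    W.trace = a * d ^ 3 + b * d ^ 2 + 2 * c * d ^ 2 + 2 * e * d ∧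
    (W * V).trace = a * d ^ 2 + b * d ^ 3 + 2 * c * d + 2 * e * d ^ 2 ∧
    (W * X).trace = a * d ^ 2 + b * d + c * (d ^ 3 + d) + 2 * e * d ^ 2 ∧
    (W * (V * X * V)).trace = a * d ^ 2 + b * d + c * (d ^ 3 + d) + 2 * e * d ^ 2 ∧
    (W * (X * V)).trace = a * d + b * d ^ 2 + 2 * c * d ^ 2 + e * (d ^ 3 + d) ∧
    (W * (V * X)).trace = a * d + b * d ^ 2 + 2 * c * d ^ 2 + e * (d ^ 3 + d) := by
  have hf : (Equiv.swap 0 1 : Equiv.Perm (Fin 3)) 2 = 2 := by decide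
  have t1 : (1 : Matrix (Idx d) (Idx d) ℂ).trace = (d : ℂ) ^ 3 := by simp
  have tV : V.trace = (d : ℂ) ^ 2 := hV ▸ trace_Perm3_swap_zero_one d
  have tX : X.trace = (d : ℂ) ^ 2 := by rw [hX, trace_pt3, trace_Perm3_swap_one_two]
  have tXV : (X * V).trace = d := by
    rw [hX, hV, ← pt3_mul_Perm3 d hf, trace_pt3, ← Perm3_mul, trace_Perm3_cycle]
  have tVX : (V * X).trace = d := by rw [Matrix.trace_mul_comm, tXV]
  have VV : V * V = 1 := by rw [hV, ← Perm3_mul, Equiv.swap_mul_self, Perm3_one]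
  have VVM (M : Matrix (Idx d) (Idx d) ℂ) : V * (V * M) = M := by
    rw [← Matrix.mul_assoc, VV, Matrix.one_mul]
  have XX : X * X = (d : ℂ) • X := hX ▸ pt3_swap_mul_self d
  have XXM (M : Matrix (Idx d) (Idx d) ℂ) : X * (X * M) = (d : ℂ) • (X * M) := by
    rw [← Matrix.mul_assoc, XX, Matrix.smul_mul]
  have XVX : X * (V * X) = X := by
    rw [← Matrix.mul_assoc, hX, hV, pt3_swap_mul_swap_mul d]
  have XVXM (M : Matrix (Idx d) (Idx d) ℂ) : X * (V * (X * M)) = X * M := by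
    rw [← Matrix.mul_assoc V, ← Matrix.mul_assoc, XVX]
  have tVXV : (V * (X * V)).trace = (d : ℂ) ^ 2 := by
    rw [Matrix.trace_mul_comm, Matrix.mul_assoc, VV, Matrix.mul_one, tX]
  rw [hW]
  refine ⟨?_, ?_, ?_, ?_, ?_, ?_⟩ <;>
  · simp only [Matrix.add_mul, Matrix.smul_mul, Matrix.mul_assoc, Matrix.one_mul, Matrix.mul_smul,
      Matrix.mul_one, VV, VVM, XX, XXM, XVX, XVXM, Matrix.trace_add, Matrix.trace_smul, t1, tV, tX,
      tXV, tVX, tVXV, smul_eq_mul]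
    ring

/-- Traces of the normalized operator ω̂ = (λ₀·R^{T₃} − Q^{T₃} + C^{T₃})/t against the
Eggeling–Werner basis elements S₊, S₋, S₀, S₁, S₂, S₃. -/
theorem eggeling_basis_traces
    (d : ℕ) (hd : 2 ≤ d) (δ : ℝ) (hδ : δ ∈ Set.Ico (0 : ℝ) 1) (α t : ℝ)
    (hα : α = (1 - δ) * δ * ((d : ℝ) * (δ - 1) - δ) / ((d : ℝ) ^ 3 * ((d : ℝ) + 1)))
    (ht : t = ((d : ℝ) - 1) * (1 - δ) * ((d : ℝ) ^ 2 + 2 * (d : ℝ) * (δ - 1) * δ - 2 * δ ^ 2)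
        / (d : ℝ) ^ 2)
    (ωhat V Xh Sp Sm S0 S1 S2 S3 : Matrix (Idx d) (Idx d) ℂ)
    (hω : ωhat = t⁻¹ •
      ((1 - ((d : ℝ) - 1) * δ / d) • pt3 d (Rop d δ) - pt3 d (Qop d δ)
        + pt3 d ((2 * α) • (1 : Matrix (Idx d) (Idx d) ℂ)
            - α • (Perm3 d (finRotate 3) + Perm3 d (finRotate 3)⁻¹))))
    (hV : V = Perm3 d (Equiv.swap 0 1))
    (hX : Xh = pt3 d (Perm3 d (Equiv.swap 1 2)))
    (hSp : Sp = (((2 : ℂ))⁻¹ • (1 + V)) * (1 - (2 / ((d : ℂ) + 1)) • Xh)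
        * (((2 : ℂ))⁻¹ • (1 + V)))
    (hSm : Sm = (((2 : ℂ))⁻¹ • (1 - V)) * (1 - (2 / ((d : ℂ) - 1)) • Xh)
        * (((2 : ℂ))⁻¹ • (1 - V)))
    (hS0 : S0 = (((d : ℂ) ^ 2 - 1))⁻¹ •
        ((d : ℂ) • (Xh + V * Xh * V) - (Xh * V + V * Xh)))
    (hS1 : S1 = (((d : ℂ) ^ 2 - 1))⁻¹ •
        ((d : ℂ) • (Xh * V + V * Xh) - (Xh + V * Xh * V)))
    (hS2 : S2 = ((Real.sqrt ((d : ℝ) ^ 2 - 1) : ℂ))⁻¹ • (Xh - V * Xh * V))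
    (hS3 : S3 = ((Real.sqrt ((d : ℝ) ^ 2 - 1) : ℂ))⁻¹ • (Complex.I • (Xh * V - V * Xh))) :
    0 < t ∧
    (ωhat * Sp).trace =
      ((((d : ℝ) ^ 2 * ((δ - 2) * δ + 2) + (d : ℝ) * δ ^ 2 - 2 * δ ^ 2)
        / (2 * (d : ℝ) ^ 2 + 4 * (d : ℝ) * (δ - 1) * δ - 4 * δ ^ 2) : ℝ) : ℂ) ∧
    (ωhat * Sm).trace =
      ((-(((d : ℝ) - 2) * δ * ((d : ℝ) * δ - 2 * (d : ℝ) - δ))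
        / (2 * (d : ℝ) ^ 2 + 4 * (d : ℝ) * (δ - 1) * δ - 4 * δ ^ 2) : ℝ) : ℂ) ∧
    (ωhat * S0).trace = 0 ∧ (ωhat * S1).trace = 0 ∧
    (ωhat * S2).trace = 0 ∧ (ωhat * S3).trace = 0 ∧
    (0 : ℝ) ≤ (((d : ℝ) ^ 2 * ((δ - 2) * δ + 2) + (d : ℝ) * δ ^ 2 - 2 * δ ^ 2)
        / (2 * (d : ℝ) ^ 2 + 4 * (d : ℝ) * (δ - 1) * δ - 4 * δ ^ 2)) ∧
    (0 : ℝ) ≤ (-(((d : ℝ) - 2) * δ * ((d : ℝ) * δ - 2 * (d : ℝ) - δ))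
        / (2 * (d : ℝ) ^ 2 + 4 * (d : ℝ) * (δ - 1) * δ - 4 * δ ^ 2)) ∧
    (((d : ℝ) ^ 2 * ((δ - 2) * δ + 2) + (d : ℝ) * δ ^ 2 - 2 * δ ^ 2)
        / (2 * (d : ℝ) ^ 2 + 4 * (d : ℝ) * (δ - 1) * δ - 4 * δ ^ 2))
      + (-(((d : ℝ) - 2) * δ * ((d : ℝ) * δ - 2 * (d : ℝ) - δ))
        / (2 * (d : ℝ) ^ 2 + 4 * (d : ℝ) * (δ - 1) * δ - 4 * δ ^ 2)) = 1 := by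
  have hd0 : d ≠ 0 := by lia
  have hdR : (2 : ℝ) ≤ d := by exact_mod_cast hd
  obtain ⟨hδ0, hδ1⟩ := hδ
  have hN : 0 < (d : ℝ) ^ 2 + 2 * d * (δ - 1) * δ - 2 * δ ^ 2 := by
    nlinarith [mul_nonneg (by linarith : (0 : ℝ) ≤ 2 * d - 3) (sq_nonneg δ),
      pow_pos (by linarith : (0 : ℝ) < d - δ) 2]
  have hN' : 0 < 2 * (d : ℝ) ^ 2 + 4 * d * (δ - 1) * δ - 4 * δ ^ 2 := by linarith
  have ht0 : 0 < t := by
    rw [ht]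
    have h1 : 0 < (d : ℝ) - 1 := by linarith
    have h2 : 0 < 1 - δ := by linarith
    positivity
  have hdC : (d : ℂ) ≠ 0 := Nat.cast_ne_zero.mpr hd0
  have hdC1 : (d : ℂ) + 1 ≠ 0 := by exact_mod_cast Nat.succ_ne_zero d
  have hdC2 : (d : ℂ) + 2 ≠ 0 := by exact_mod_cast Nat.succ_ne_zero (d + 1)
  have htC : (t : ℂ) ≠ 0 := Complex.ofReal_ne_zero.mpr ht0.ne'
  have hNC : 2 * (d : ℂ) ^ 2 + 4 * d * (δ - 1) * δ - 4 * δ ^ 2 ≠ 0 := by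
    exact_mod_cast Complex.ofReal_ne_zero.mpr hN'.ne'
  have htC' : (t : ℂ) * (d : ℂ) ^ 2 * 2 =
      (d - 1) * (1 - δ) * (2 * (d : ℂ) ^ 2 + 4 * d * (δ - 1) * δ - 4 * δ ^ 2) := by
    rw [ht]
    push_cast
    field_simp
    ring
  have hf : (Equiv.swap 0 1 : Equiv.Perm (Fin 3)) 2 = 2 := by decide
  have hrot : finRotate 3 = Equiv.swap 0 1 * Equiv.swap 1 2 := by decide
  have hrot' : (finRotate 3)⁻¹ = Equiv.swap 1 2 * Equiv.swap 0 1 := by decide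
  have hC : pt3 d ((2 * α) • (1 : Matrix (Idx d) (Idx d) ℂ)
      - α • (Perm3 d (finRotate 3) + Perm3 d (finRotate 3)⁻¹)) =
      (2 * α : ℂ) • (1 : Matrix (Idx d) (Idx d) ℂ) - (α : ℂ) • (Xh * V + V * Xh) := by
    rw [hrot', hrot, ← Complex.coe_smul, ← Complex.coe_smul, pt3_sub, pt3_smul, pt3_smul, pt3_add,
      pt3_one, Perm3_mul, Perm3_mul, pt3_mul_Perm3 d hf, pt3_Perm3_mul d hf, ← hX, ← hV, add_comm]
    push_cast
    rfl
  let r : ℂ := ((d : ℂ) * (d + 1))⁻¹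
  let q : ℂ := ((d : ℂ) * (d + 1) * (d + 2))⁻¹
  let l : ℂ := 1 - (d - 1) * δ / d
  have hω' : ωhat =
      ((t : ℂ)⁻¹ * (l * r * (1 + (2 - δ) * (δ / d))
        - q * (1 + (4 - δ) * (δ / d) + 2 * (δ / d) ^ 2) + 2 * α)) • 1
      + ((t : ℂ)⁻¹ * (l * r - q) * (1 - δ) ^ 2) • V
      + (-(t : ℂ)⁻¹ * q * ((1 - δ) * (1 + 2 * (δ / d)))) • (Xh + V * Xh * V)
      + (-(t : ℂ)⁻¹ * (q * (1 - δ) ^ 2 + α)) • (Xh * V + V * Xh) := by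
    rw [hω, hC, pt3_Rop hd0, pt3_Qop hd0 δ hV hX, ← hV, ← Complex.coe_smul, ← Complex.coe_smul]
    push_cast
    module
  obtain ⟨h1, h2, h3, h4, h5, h6⟩ := trace_mul_word hV hX hω'
  have hαC : (α : ℂ) = (1 - δ) * δ * (d * (δ - 1) - δ) / ((d : ℂ) ^ 3 * (d + 1)) := by
    rw [hα]
    push_cast
    rfl
  have hX0 : (ωhat * Xh).trace = 0 := by
    rw [h3, hαC]
    simp only [r, q, l]
    field_simp
    ring
  have hVXV0 : (ωhat * (V * Xh * V)).trace = 0 := by rw [h4, ← h3, hX0]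
  have hXV0 : (ωhat * (Xh * V)).trace = 0 := by
    rw [h5, hαC]
    simp only [r, q, l]
    field_simp
    ring
  have hVX0 : (ωhat * (V * Xh)).trace = 0 := by rw [h6, ← h5, hXV0]
  have VV : V * V = 1 := by rw [hV, ← Perm3_mul, Equiv.swap_mul_self, Perm3_one]
  have hSp' : Sp = (2 : ℂ)⁻¹ • (1 + V)
      - (2⁻¹ / ((d : ℂ) + 1)) • (Xh + Xh * V + V * Xh + V * Xh * V) := by
    rw [hSp]
    simp only [Matrix.mul_add, Matrix.add_mul, Matrix.mul_sub, Matrix.sub_mul, Matrix.smul_mul,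
      Matrix.mul_smul, Matrix.mul_one, Matrix.one_mul, VV]
    module
  have hSm' : Sm = (2 : ℂ)⁻¹ • (1 - V)
      - (2⁻¹ / ((d : ℂ) - 1)) • (Xh - Xh * V - V * Xh + V * Xh * V) := by
    rw [hSm]
    simp only [Matrix.mul_sub, Matrix.sub_mul, Matrix.smul_mul,
      Matrix.mul_smul, Matrix.mul_one, Matrix.one_mul, VV]
    module
  refine ⟨ht0, ?_, ?_, ?_, ?_, ?_, ?_, ?_, ?_, ?_⟩
  · rw [hSp']
    simp only [Matrix.mul_add, Matrix.mul_sub, Matrix.mul_smul, Matrix.mul_one, Matrix.trace_add,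
      Matrix.trace_sub, Matrix.trace_smul, hX0, hVXV0, hXV0, hVX0, h1, h2, smul_eq_mul, add_zero,
      sub_zero, mul_zero]
    push_cast
    rw [eq_div_iff hNC, ← mul_right_inj' htC, hαC]
    simp only [r, q, l]
    field_simp
    linear_combination (-((d : ℂ) + 1) * (d + 2) *
      ((d : ℂ) ^ 2 * ((δ - 2) * δ + 2) + d * δ ^ 2 - 2 * δ ^ 2)) * htC'
  · rw [hSm']
    simp only [Matrix.mul_add, Matrix.mul_sub, Matrix.mul_smul, Matrix.mul_one, Matrix.trace_add,
      Matrix.trace_sub, Matrix.trace_smul, hX0, hVXV0, hXV0, hVX0, h1, h2, smul_eq_mul, add_zero,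
      sub_zero, mul_zero]
    push_cast
    rw [eq_div_iff hNC, ← mul_right_inj' htC, hαC]
    simp only [r, q, l]
    field_simp
    linear_combination (((d : ℂ) + 1) * (d + 2) * ((d - 2) * δ * (d * δ - 2 * d - δ))) * htC'
  · simp [hS0, Matrix.mul_add, Matrix.mul_sub, Matrix.trace_add, Matrix.trace_sub, hX0, hVXV0,
      hXV0, hVX0]
  · simp [hS1, Matrix.mul_add, Matrix.mul_sub, Matrix.trace_add, Matrix.trace_sub, hX0, hVXV0,
      hXV0, hVX0]
  · simp [hS2, Matrix.mul_sub, Matrix.trace_sub, hX0, hVXV0]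
  · simp [hS3, Matrix.mul_sub, Matrix.trace_sub, hXV0, hVX0]
  · refine div_nonneg ?_ hN'.le
    nlinarith [mul_nonneg (sq_nonneg (d : ℝ)) (sq_nonneg (δ - 1)),
      mul_nonneg (by linarith : (0 : ℝ) ≤ d - 2) (sq_nonneg δ), sq_nonneg (d : ℝ)]
  · refine div_nonneg ?_ hN'.le
    have h : 0 ≤ 2 * (d : ℝ) + δ - d * δ := by nlinarith
    linarith [mul_nonneg (mul_nonneg (by linarith : (0 : ℝ) ≤ d - 2) hδ0) h]
  · rw [← add_div, div_eq_one_iff_eq hN'.ne']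
    ring
end
end
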